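/- arXiv:1309.4810 — 2 statements merged into one kernel-verified Lean document; each statement's English description precedes it below -/
import Mathlib

section
/- For every value c ∈ {7, 8, 9, 10, 11, 12, 13, 14, 15, 16}, there exist infinitely many integers n ≥ 1 such that the abelian complexity of the 4-bonacci word satisfies ρ_q(n) = c. -/
/-- The m-bonacci substitution on letters. -/
def mbSub (m : ℕ) (ℓ : ℕ) : List ℕ :=
  if ℓ = m - 1 then [0] else [0, ℓ + 1]

/-- Application of the m-bonacci substitution to a word. -/
def mbApply (m : ℕ) (w : List ℕ) : List ℕ := w.flatMap (mbSub m)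

/-- σ_m^k(0). -/
def mbIter (m k : ℕ) : List ℕ := (mbApply m)^[k] [0]

/-- w is a factor of the m-bonacci word. -/
def mbFactor (m : ℕ) (w : List ℕ) : Prop := ∃ k, w <:+: mbIter m k

/-- The prefix of length n of the m-bonacci word. -/
def mbPrefix (m n : ℕ) : List ℕ := (mbIter m n).take n

/-- Abelian complexity: number of distinct Parikh vectors of factors of length n. -/
noncomputable def mbAC (m n : ℕ) : ℕ :=
  Set.ncard ((fun (w : List ℕ) (ℓ : ℕ) => w.count ℓ) ''
    {w : List ℕ | mbFactor m w ∧ w.length = n})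

/-- Tribonacci numbers. -/
def tribN : ℕ → ℕ
  | 0 => 0
  | 1 => 0
  | 2 => 1
  | n + 3 => tribN (n + 2) + tribN (n + 1) + tribN n

/-- Value of a digit string (most significant digit first) in the Tribonacci system. -/
def valT : List ℕ → ℕ
  | [] => 0
  | d :: rest => d * tribN (rest.length + 3) + valT rest

/-- L is the normal T-representation of n (MSB first, greedy). -/
def IsNormalTRep (n : ℕ) (L : List ℕ) : Prop :=
  (∀ d ∈ L, d ≤ 1) ∧ (∀ d ∈ L.take 1, d = 1) ∧ valT L = n ∧
    ∀ S, S <:+ L → valT S < tribN (S.length + 3)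

/-- Value of a digit string (MSB first) in the m-bonacci numeration system U_j = |σ_m^j(0)|. -/
def valU (m : ℕ) : List ℕ → ℕ
  | [] => 0
  | d :: rest => d * (mbIter m rest.length).length + valU m rest

/-- L is the normal U-representation of n (MSB first, greedy) in the m-bonacci system. -/
def IsNormalURep (m n : ℕ) (L : List ℕ) : Prop :=
  (∀ d ∈ L, d ≤ 1) ∧ (∀ d ∈ L.take 1, d = 1) ∧ valU m L = n ∧
    ∀ S, S <:+ L → valU m S < (mbIter m S.length).length

/-! ### Prefixes of the 4-bonacci word -/

namespace FourBonacci

lemma mbIter_succ (m k : ℕ) : mbIter m (k + 1) = mbApply m (mbIter m k) :=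
  Function.iterate_succ_apply' _ _ _

lemma mbApply_append (m : ℕ) (u w : List ℕ) :
    mbApply m (u ++ w) = mbApply m u ++ mbApply m w := List.flatMap_append

lemma mbApply_cons (m a : ℕ) (w : List ℕ) : mbApply m (a :: w) = mbSub m a ++ mbApply m w :=
  List.flatMap_cons

lemma mbApply_prefix (m : ℕ) {u w : List ℕ} (h : u <+: w) : mbApply m u <+: mbApply m w := by
  obtain ⟨t, rfl⟩ := h
  exact ⟨mbApply m t, (mbApply_append m u t).symm⟩

lemma mbIter_prefix_succ (k : ℕ) : mbIter 4 k <+: mbIter 4 (k + 1) := by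
  induction k with
  | zero => exact ⟨[1], rfl⟩
  | succ k ih => rw [mbIter_succ 4 k, mbIter_succ 4 (k + 1)]; exact mbApply_prefix 4 ih

lemma mbIter_prefix {k l : ℕ} (h : k ≤ l) : mbIter 4 k <+: mbIter 4 l := by
  induction l, h using Nat.le_induction with
  | base => exact List.prefix_rfl
  | succ l _ ih => exact ih.trans (mbIter_prefix_succ l)

lemma length_le_length_mbApply (m : ℕ) (w : List ℕ) : w.length ≤ (mbApply m w).length := by
  induction w with
  | nil => simp
  | cons a w ih =>
    have : 1 ≤ (mbSub m a).length := by unfold mbSub; split_ifs <;> simp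
    rw [mbApply_cons, List.length_append, List.length_cons]
    omega

lemma lt_length_mbIter (k : ℕ) : k < (mbIter 4 k).length := by
  induction k with
  | zero => simp [mbIter]
  | succ k ih =>
    obtain ⟨t, ht⟩ : [0] <+: mbIter 4 k := mbIter_prefix (Nat.zero_le k)
    have h := length_le_length_mbApply 4 t
    rw [← ht] at ih
    rw [mbIter_succ, ← ht, List.singleton_append, mbApply_cons, mbSub, if_neg (by decide)]
    simp only [List.length_append, List.length_cons, List.length_nil] at *
    omega

lemma length_mbPrefix (n : ℕ) : (mbPrefix 4 n).length = n := by
  have := lt_length_mbIter n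
  simp only [mbPrefix, List.length_take]
  omega

lemma eq_mbPrefix {w : List ℕ} {k : ℕ} (h : w <+: mbIter 4 k) : w = mbPrefix 4 w.length := by
  have h₁ := h.trans (mbIter_prefix (le_max_left k w.length))
  have h₂ : mbPrefix 4 w.length <+: mbIter 4 (max k w.length) :=
    (List.take_prefix _ _).trans (mbIter_prefix (le_max_right k w.length))
  exact (List.prefix_of_prefix_length_le h₁ h₂ (length_mbPrefix _).ge).eq_of_length
    (length_mbPrefix _).symm

lemma mbPrefix_prefix_mbIter (n : ℕ) : mbPrefix 4 n <+: mbIter 4 n := List.take_prefix _ _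

lemma mbPrefix_prefix {m n : ℕ} (h : m ≤ n) : mbPrefix 4 m <+: mbPrefix 4 n := by
  have h₁ := (mbPrefix_prefix_mbIter m).trans (mbIter_prefix h)
  exact List.prefix_of_prefix_length_le h₁ (mbPrefix_prefix_mbIter n) (by simpa [length_mbPrefix])

/-- The letter at position `n` of the 4-bonacci word. -/
def letter (n : ℕ) : ℕ := (mbPrefix 4 (n + 1)).getD n 0

lemma mbPrefix_succ (n : ℕ) : mbPrefix 4 (n + 1) = mbPrefix 4 n ++ [letter n] := by
  obtain ⟨t, ht⟩ := mbPrefix_prefix n.le_succ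
  have hl := congrArg List.length ht
  simp only [List.length_append, length_mbPrefix] at hl
  obtain ⟨a, rfl⟩ := List.length_eq_one_iff.mp (show t.length = 1 by omega)
  rw [letter, ← ht]
  simp [List.getD, length_mbPrefix]

lemma letter_of_prefix {n a k : ℕ} (h : mbPrefix 4 n ++ [a] <+: mbIter 4 k) : letter n = a := by
  have := eq_mbPrefix h
  rw [List.length_append, length_mbPrefix, List.length_singleton, mbPrefix_succ] at this
  simpa using this.symm

/-- The position in the 4-bonacci word at which the image of its `n`-th letter starts. -/
def blockStart (n : ℕ) : ℕ := (mbApply 4 (mbPrefix 4 n)).length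

lemma mbApply_mbPrefix_prefix (n : ℕ) : mbApply 4 (mbPrefix 4 n) <+: mbIter 4 (n + 1) := by
  rw [mbIter_succ]; exact mbApply_prefix 4 (mbPrefix_prefix_mbIter n)

lemma mbPrefix_blockStart (n : ℕ) : mbPrefix 4 (blockStart n) = mbApply 4 (mbPrefix 4 n) :=
  (eq_mbPrefix (mbApply_mbPrefix_prefix n)).symm

lemma mbPrefix_blockStart_append (n : ℕ) :
    mbPrefix 4 (blockStart n) ++ mbSub 4 (letter n) <+: mbIter 4 (n + 2) := by
  have h := mbApply_mbPrefix_prefix (n + 1)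
  rw [mbPrefix_succ, mbApply_append] at h
  simpa [mbPrefix_blockStart, mbApply_cons, mbApply] using h

lemma letter_blockStart (n : ℕ) : letter (blockStart n) = 0 := by
  refine letter_of_prefix (List.IsPrefix.trans ?_ (mbPrefix_blockStart_append n))
  rw [List.prefix_append_right_inj]
  unfold mbSub
  split_ifs <;> simp

lemma letter_blockStart_add_one {n : ℕ} (h : letter n ≠ 3) :
    letter (blockStart n + 1) = letter n + 1 := by
  refine letter_of_prefix (k := n + 2) ?_
  rw [mbPrefix_succ, letter_blockStart]
  simpa [mbSub, h] using mbPrefix_blockStart_append n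

lemma blockStart_succ (n : ℕ) :
    blockStart (n + 1) = blockStart n + if letter n = 3 then 1 else 2 := by
  rw [blockStart, mbPrefix_succ, mbApply_append, List.length_append, blockStart]
  simp only [mbApply, List.flatMap_cons, List.flatMap_nil, List.append_nil, mbSub]
  split_ifs <;> simp_all

lemma blockStart_zero : blockStart 0 = 0 := rfl

lemma le_blockStart (n : ℕ) : n ≤ blockStart n := by
  simpa [length_mbPrefix, blockStart] using length_le_length_mbApply 4 (mbPrefix 4 n)

lemma lt_blockStart {n : ℕ} (h : 0 < n) : n < blockStart n := by
  induction n, h using Nat.le_induction with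
  | base => decide
  | succ n _ ih => rw [blockStart_succ]; split_ifs <;> omega

/-- The pairs formed by an offset in the image of the letter `a` and the letter found there. -/
def offsets (a : ℕ) : List (ℕ × ℕ) := if a = 3 then [(0, 0)] else [(0, 0), (1, a + 1)]

lemma mem_offsets {a e x : ℕ} :
    (e, x) ∈ offsets a ↔ (e = 0 ∧ x = 0) ∨ (a ≠ 3 ∧ e = 1 ∧ x = a + 1) := by
  unfold offsets
  split_ifs with h <;> simp [h]

lemma letter_of_mem_offsets {j e a : ℕ} (h : (e, a) ∈ offsets (letter j)) :
    letter (blockStart j + e) = a := by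
  rcases mem_offsets.mp h with ⟨rfl, rfl⟩ | ⟨h3, rfl, rfl⟩
  · exact letter_blockStart j
  · exact letter_blockStart_add_one h3

lemma exists_offset (i : ℕ) :
    ∃ j e, i = blockStart j + e ∧ (e, letter i) ∈ offsets (letter j) := by
  induction i with
  | zero => exact ⟨0, 0, rfl, mem_offsets.mpr (.inl ⟨rfl, letter_blockStart 0⟩)⟩
  | succ i ih =>
    obtain ⟨j, e, rfl, h⟩ := ih
    have hs := blockStart_succ j
    by_cases hj : letter j ≠ 3 ∧ e = 0
    · obtain ⟨h3, rfl⟩ := hj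
      exact ⟨j, 1, rfl, mem_offsets.mpr (.inr ⟨h3, rfl, letter_blockStart_add_one h3⟩)⟩
    · have : blockStart j + e + 1 = blockStart (j + 1) := by
        rcases mem_offsets.mp h with ⟨rfl, -⟩ | ⟨h3, rfl, -⟩
        · simp_all
        · simp_all [add_assoc]
      exact ⟨j + 1, 0, this, mem_offsets.mpr (.inl ⟨rfl, by rw [this, letter_blockStart]⟩)⟩

lemma letter_le (n : ℕ) : letter n ≤ 3 := by
  induction n using Nat.strong_induction_on with
  | _ n ih =>
    obtain ⟨j, e, rfl, h⟩ := exists_offset n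
    rcases mem_offsets.mp h with ⟨-, h⟩ | ⟨h3, rfl, h⟩
    · omega
    · have := ih j (by have := le_blockStart j; omega)
      omega

/-- The number of occurrences of `ℓ` in the prefix of length `n` of the 4-bonacci word. -/
def occ (ℓ n : ℕ) : ℕ := (mbPrefix 4 n).count ℓ

lemma occ_zero (ℓ : ℕ) : occ ℓ 0 = 0 := by simp [occ, mbPrefix]

lemma occ_succ (ℓ n : ℕ) : occ ℓ (n + 1) = occ ℓ n + if letter n = ℓ then 1 else 0 := by
  simp [occ, mbPrefix_succ, List.count_singleton]

lemma occ_mono (ℓ : ℕ) : Monotone (occ ℓ) :=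
  monotone_nat_of_le_succ fun n => by rw [occ_succ]; omega

lemma occ_eq_zero {ℓ : ℕ} (h : 3 < ℓ) (n : ℕ) : occ ℓ n = 0 := by
  induction n with
  | zero => exact occ_zero ℓ
  | succ n ih => rw [occ_succ, ih, if_neg (by have := letter_le n; omega)]

lemma sum_occ (n : ℕ) : occ 0 n + occ 1 n + occ 2 n + occ 3 n = n := by
  induction n with
  | zero => simp [occ_zero]
  | succ n ih =>
    have := letter_le n
    simp only [occ_succ]
    interval_cases letter n <;> simp <;> omega

lemma occ_zero_blockStart (n : ℕ) : occ 0 (blockStart n) = n := by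
  induction n with
  | zero => rfl
  | succ n ih =>
    rw [blockStart_succ]
    split_ifs with h
    · simp [occ_succ, ih, letter_blockStart]
    · simp [occ_succ, ih, letter_blockStart, letter_blockStart_add_one h]

lemma occ_succ_blockStart {ℓ : ℕ} (hℓ : ℓ ≠ 3) (n : ℕ) :
    occ (ℓ + 1) (blockStart n) = occ ℓ n := by
  induction n with
  | zero => rw [blockStart_zero, occ_zero, occ_zero]
  | succ n ih =>
    rw [blockStart_succ, occ_succ ℓ]
    split_ifs with h h' h'
    · omega
    · simp [occ_succ, ih, letter_blockStart]
    · simp [occ_succ, ih, letter_blockStart, letter_blockStart_add_one h, h']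
    · simp [occ_succ, ih, letter_blockStart, letter_blockStart_add_one h, h']

lemma occ_blockStart_add {e : ℕ} (he : e ≤ 1) (n : ℕ) :
    occ 0 (blockStart n + e) = n + e ∧ occ 1 (blockStart n + e) = occ 0 n ∧
      occ 2 (blockStart n + e) = occ 1 n ∧ occ 3 (blockStart n + e) = occ 2 n := by
  have h₀ := occ_zero_blockStart n
  have h₁ := occ_succ_blockStart (ℓ := 0) (by decide) n
  have h₂ := occ_succ_blockStart (ℓ := 1) (by decide) n
  have h₃ := occ_succ_blockStart (ℓ := 2) (by decide) n
  interval_cases e <;> simp_all [occ_succ, letter_blockStart]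

/-- The Parikh vectors of the factors of length `n` are differences of those of prefixes. -/
lemma mbAC_eq (n : ℕ) :
    mbAC 4 n = (Set.range fun i ℓ => occ ℓ (i + n) - occ ℓ i).ncard := by
  rw [mbAC]
  congr 1
  ext f
  constructor
  · rintro ⟨w, ⟨⟨k, s, t, hst⟩, rfl⟩, rfl⟩
    refine ⟨s.length, funext fun ℓ => ?_⟩
    have h₁ := eq_mbPrefix (w := s) (k := k) ⟨w ++ t, by simp [← hst]⟩
    have h₂ := eq_mbPrefix (w := s ++ w) (k := k) ⟨t, hst⟩
    rw [List.length_append] at h₂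
    simp [occ, ← h₁, ← h₂]
  · rintro ⟨i, rfl⟩
    obtain ⟨w, hw⟩ := mbPrefix_prefix (Nat.le_add_right i n)
    have hl := congrArg List.length hw
    simp only [List.length_append, length_mbPrefix] at hl
    refine ⟨w, ⟨⟨i + n, (List.infix_append' (mbPrefix 4 i) w []).trans ?_⟩, by omega⟩,
      funext fun ℓ => ?_⟩
    · simpa [hw] using (mbPrefix_prefix_mbIter (i + n)).isInfix
    · simp [occ, ← hw]


/-- Binary search trees of natural numbers, used to sort lists and remove duplicates. -/
inductive CodeTree where
  | leaf : CodeTree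
  | node : CodeTree → ℕ → CodeTree → CodeTree

namespace CodeTree

/-- Insertion of a number. -/
def insert (k : ℕ) : CodeTree → CodeTree
  | leaf => node leaf k leaf
  | node l x r =>
    bif Nat.blt k x then node (l.insert k) x r
    else bif Nat.beq k x then node l x r
    else node l x (r.insert k)

/-- The list of entries, prepended to an accumulator. -/
def toList : CodeTree → List ℕ → List ℕ
  | leaf, acc => acc
  | node l x r, acc => l.toList (x :: r.toList acc)

/-- The tree of entries of a list. -/
def ofList (L : List ℕ) : CodeTree := L.foldl (fun t k => t.insert k) leaf

lemma mem_toList {x : ℕ} (t : CodeTree) (acc : List ℕ) :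
    x ∈ t.toList acc ↔ x ∈ t.toList [] ∨ x ∈ acc := by
  induction t generalizing acc with
  | leaf => simp [toList]
  | node l y r ihl ihr =>
    simp only [toList]
    rw [ihl (y :: r.toList acc), ihl (y :: r.toList []), List.mem_cons, List.mem_cons, ihr acc]
    tauto

lemma mem_toList_node {x y : ℕ} {l r : CodeTree} :
    x ∈ (node l y r).toList [] ↔ x ∈ l.toList [] ∨ x = y ∨ x ∈ r.toList [] := by
  rw [toList, mem_toList, List.mem_cons]

lemma mem_toList_insert {x k : ℕ} (t : CodeTree) :
    x ∈ (t.insert k).toList [] ↔ x = k ∨ x ∈ t.toList [] := by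
  induction t with
  | leaf => simp [insert, toList]
  | node l y r ihl ihr =>
    rw [insert, mem_toList_node]
    cases Nat.blt k y
    · cases h : Nat.beq k y
      · simp only [cond_false, mem_toList_node, ihr]
        tauto
      · simp only [cond_false, cond_true, mem_toList_node, Nat.eq_of_beq_eq_true h]
        tauto
    · simp only [cond_true, mem_toList_node, ihl]
      tauto

lemma mem_toList_ofList {x : ℕ} (L : List ℕ) : x ∈ (ofList L).toList [] ↔ x ∈ L := by
  suffices ∀ t : CodeTree, x ∈ (L.foldl (fun t k => t.insert k) t).toList [] ↔
      x ∈ t.toList [] ∨ x ∈ L by simpa [toList, ofList] using this leaf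
  induction L with
  | nil => simp
  | cons k L ih =>
    intro t
    rw [List.foldl_cons, ih, mem_toList_insert, List.mem_cons]
    tauto

end CodeTree

/-- Application of a function, by a recursion that makes the kernel evaluate the argument first. -/
def force {α : Type} (n : ℕ) (f : ℕ → α) : α := Nat.rec (f 0) (fun k _ => f (k + 1)) n

lemma force_eq {α : Type} (n : ℕ) (f : ℕ → α) : force n f = f n := by
  cases n <;> rfl

/-- The test keeping the codes of small weight: `y` is the shifted first coordinate, and the base
16 digits of `T` are the other ones. -/
def near (y T : ℕ) : Bool :=
  Nat.ble (10000 * y + 9275 * (T / 256) + 7878 * (T / 16 % 16) + 5187 * (T % 16)) 183750 &&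
    Nat.ble 139650 (10000 * y + 9276 * (T / 256) + 7880 * (T / 16 % 16) + 5188 * (T % 16))

/-- The sum of the shifted coordinates of a code. -/
def digitSum (c : ℕ) : ℕ := c / 65536 + c / 4096 % 16 + c / 256 % 16 + c / 16 % 16

/-- The shifted first coordinate of a successor of `c`. -/
def nextDigit (d c e f : ℕ) : ℕ := digitSum c + f - (15 + d + e)

/-- The successor of the code `c` along the digit `d` with offset and letter `p` on the left and
`q` on the right. -/
def next (d c : ℕ) (p q : ℕ × ℕ) : ℕ :=
  65536 * nextDigit d c p.1 q.1 + 16 * (c / 256) + 4 * p.2 + q.2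

/-- All successors of small weight. -/
def successors (d c : ℕ) : List ℕ :=
  (offsets (c / 4 % 4)).flatMap fun p => (offsets (c % 4)).flatMap fun q =>
    bif near (nextDigit d c p.1 q.1) (c / 256) then force (next d c p q) fun k => [k] else []

/-- The test that no subtraction is truncated and no digit overflows. -/
def regular (c : ℕ) : Bool := Nat.ble 17 (digitSum c) && Nat.blt c 1048576

/-- One transition of the finite automaton reading digits. -/
def step (S : List ℕ) (d : ℕ) : Option (List ℕ) :=
  bif S.all regular then some ((CodeTree.ofList (S.flatMap (successors d))).toList []) else none

lemma step_eq_some {S S' : List ℕ} {d : ℕ} (h : step S d = some S') :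
    (∀ c ∈ S, 17 ≤ digitSum c ∧ c < 1048576) ∧
    ∀ k, k ∈ S' ↔ ∃ c ∈ S, ∃ p ∈ offsets (c / 4 % 4), ∃ q ∈ offsets (c % 4),
      near (nextDigit d c p.1 q.1) (c / 256) = true ∧ k = next d c p q := by
  rw [step] at h
  cases hr : S.all regular
  · simp [hr] at h
  · rw [hr, cond_true, Option.some.injEq] at h
    subst h
    refine ⟨?_, fun k => ?_⟩
    · simpa [regular] using hr
    · simp only [CodeTree.mem_toList_ofList, List.mem_flatMap, successors]
      refine exists_congr fun c => and_congr_right fun _ => exists_congr fun p =>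
        and_congr_right fun _ => exists_congr fun q => and_congr_right fun _ => ?_
      cases near (nextDigit d c p.1 q.1) (c / 256) <;> simp [force_eq]

/-- The deviation from additivity of the number of occurrences of `ℓ`. -/
def diff (n j l ℓ : ℕ) : ℤ := occ ℓ l - occ ℓ j - occ ℓ n

lemma diff_blockStart {d e f : ℕ} (hd : d ≤ 1) (he : e ≤ 1) (hf : f ≤ 1) (n j l : ℕ) :
    diff (blockStart n + d) (blockStart j + e) (blockStart l + f) 0 =
        diff n j l 0 + diff n j l 1 + diff n j l 2 + diff n j l 3 + f - e - d ∧
      diff (blockStart n + d) (blockStart j + e) (blockStart l + f) 1 = diff n j l 0 ∧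
      diff (blockStart n + d) (blockStart j + e) (blockStart l + f) 2 = diff n j l 1 ∧
      diff (blockStart n + d) (blockStart j + e) (blockStart l + f) 3 = diff n j l 2 := by
  obtain ⟨n₀, n₁, n₂, n₃⟩ := occ_blockStart_add hd n
  obtain ⟨j₀, j₁, j₂, j₃⟩ := occ_blockStart_add he j
  obtain ⟨l₀, l₁, l₂, l₃⟩ := occ_blockStart_add hf l
  have := sum_occ n
  have := sum_occ j
  have := sum_occ l
  simp only [diff, n₀, n₁, n₂, n₃, j₀, j₁, j₂, j₃, l₀, l₁, l₂, l₃, and_true]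
  omega

/-- `c` encodes the deviations of the prefixes of lengths `n`, `j`, `l` and the letters following
the last two. -/
structure Codes (c n j l : ℕ) : Prop where
  zero : diff n j l 0 = (c / 65536 : ℕ) - 5
  one : diff n j l 1 = (c / 4096 % 16 : ℕ) - 5
  two : diff n j l 2 = (c / 256 % 16 : ℕ) - 5
  three : diff n j l 3 = (c / 16 % 16 : ℕ) - 5
  left : c / 4 % 4 = letter j
  right : c % 4 = letter l

lemma Codes.next {c n j l d : ℕ} {p q : ℕ × ℕ} (h : Codes c n j l) (hd : d ≤ 1)
    (hc : 17 ≤ digitSum c ∧ c < 1048576) (hp : p ∈ offsets (letter j))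
    (hq : q ∈ offsets (letter l)) :
    Codes (next d c p q) (blockStart n + d) (blockStart j + p.1) (blockStart l + q.1) ∧
      diff (blockStart n + d) (blockStart j + p.1) (blockStart l + q.1) 0 =
        nextDigit d c p.1 q.1 - 5 := by
  obtain ⟨e, a⟩ := p
  obtain ⟨f, b⟩ := q
  have hj := letter_le j
  have hl := letter_le l
  have ha := letter_of_mem_offsets hp
  have hb := letter_of_mem_offsets hq
  rw [mem_offsets] at hp hq
  have he : e ≤ 1 := by omega
  have hf : f ≤ 1 := by omega
  have ha3 : a ≤ 3 := by omega
  have hb3 : b ≤ 3 := by omega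
  obtain ⟨h₀, h₁, h₂, h₃⟩ := diff_blockStart hd he hf n j l
  have hy : diff (blockStart n + d) (blockStart j + e) (blockStart l + f) 0 =
      nextDigit d c e f - 5 := by
    rw [h₀, h.zero, h.one, h.two, h.three, nextDigit]
    have := hc.1
    unfold digitSum at *
    omega
  refine ⟨?_, hy⟩
  simp only [FourBonacci.next]
  generalize nextDigit d c e f = y at hy
  have hc' := hc.2
  constructor
  · simp only [hy]; omega
  · simp only [h₁, h.zero]; omega
  · simp only [h₂, h.one]; omega
  · simp only [h₃, h.two]; omega
  · simp only [ha]; omega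
  · simp only [hb]; omega

/-- The dominant root `β` of `x⁴ = x³ + x² + x + 1` and the other coordinates of a left
eigenvector of the incidence matrix of the substitution. -/
structure Weights where
  β : ℝ
  p : ℝ
  q : ℝ
  r : ℝ
  one_add_p : 1 + p = β
  one_add_q : 1 + q = β * p
  one_add_r : 1 + r = β * q
  one_eq : 1 = β * r
  p_bounds : 0.9275 ≤ p ∧ p ≤ 0.9276
  q_bounds : 0.7878 ≤ q ∧ q ≤ 0.7880
  r_bounds : 0.5187 ≤ r ∧ r ≤ 0.5188

lemma nonempty_weights : Nonempty Weights := by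
  obtain ⟨x, ⟨h₁, h₂⟩, hx⟩ : (0 : ℝ) ∈ (fun x : ℝ => x ^ 4 - x ^ 3 - x ^ 2 - x - 1) ''
      Set.Icc 1.92756 1.92757 :=
    intermediate_value_Icc (by norm_num) (by fun_prop) ⟨by norm_num, by norm_num⟩
  simp only at hx
  have h0 : 0 < x := by linarith
  have hr : x⁻¹ = x ^ 3 - x ^ 2 - x - 1 := by
    field_simp
    linarith
  refine ⟨⟨x, x - 1, x ^ 2 - x - 1, x⁻¹, by ring, by ring, by rw [hr]; ring, by field_simp,
    ⟨by linarith, by linarith⟩, ⟨by nlinarith, by nlinarith⟩, ⟨?_, ?_⟩⟩⟩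
  · rw [le_inv_comm₀ (by norm_num) h0]
    exact h₂.trans (by norm_num)
  · rw [inv_le_comm₀ h0 (by norm_num)]
    exact le_trans (by norm_num) h₁

namespace Weights

variable (W : Weights)

/-- The weight of the deviations of the prefixes of lengths `n`, `j`, `l`. -/
def weight (n j l : ℕ) : ℝ :=
  diff n j l 0 + W.p * diff n j l 1 + W.q * diff n j l 2 + W.r * diff n j l 3

lemma weight_blockStart {d e f : ℕ} (hd : d ≤ 1) (he : e ≤ 1) (hf : f ≤ 1) (n j l : ℕ) :
    W.weight (blockStart n + d) (blockStart j + e) (blockStart l + f) =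
      W.β * W.weight n j l + (f - e - d) := by
  obtain ⟨h₀, h₁, h₂, h₃⟩ := diff_blockStart hd he hf n j l
  simp only [weight, h₀, h₁, h₂, h₃]
  push_cast
  linear_combination (diff n j l 0 : ℝ) * W.one_add_p + diff n j l 1 * W.one_add_q +
    diff n j l 2 * W.one_add_r + diff n j l 3 * W.one_eq

/-- Bounded weights of images come from bounded weights. -/
lemma abs_weight_le {d e f n j l : ℕ} (hd : d ≤ 1) (he : e ≤ 1) (hf : f ≤ 1)
    (h : |W.weight (blockStart n + d) (blockStart j + e) (blockStart l + f)| ≤ 2.2) :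
    |W.weight n j l| ≤ 2.2 := by
  rw [W.weight_blockStart hd he hf, abs_le] at h
  have := W.one_add_p
  have := W.p_bounds.1
  have hd' : (d : ℝ) ≤ 1 := by exact_mod_cast hd
  have he' : (e : ℝ) ≤ 1 := by exact_mod_cast he
  have hf' : (f : ℝ) ≤ 1 := by exact_mod_cast hf
  have := d.cast_nonneg (α := ℝ)
  have := e.cast_nonneg (α := ℝ)
  have := f.cast_nonneg (α := ℝ)
  rw [abs_le]
  constructor <;> by_contra! <;> nlinarith

lemma near_of_abs_weight_le {n j l y T : ℕ} (h : |W.weight n j l| ≤ 2.2)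
    (h₀ : diff n j l 0 = y - 5) (h₁ : diff n j l 1 = (T / 256 : ℕ) - 5)
    (h₂ : diff n j l 2 = (T / 16 % 16 : ℕ) - 5) (h₃ : diff n j l 3 = (T % 16 : ℕ) - 5) :
    near y T = true := by
  simp only [near, Bool.and_eq_true, Nat.ble_eq]
  rw [weight, h₀, h₁, h₂, h₃, abs_le] at h
  generalize T / 256 = u at *
  generalize T / 16 % 16 = v at *
  generalize T % 16 = w at *
  push_cast at h
  obtain ⟨hp, hp'⟩ := W.p_bounds
  obtain ⟨hq, hq'⟩ := W.q_bounds
  obtain ⟨hr, hr'⟩ := W.r_bounds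
  have := mul_le_mul_of_nonneg_right hp u.cast_nonneg
  have := mul_le_mul_of_nonneg_right hp' u.cast_nonneg
  have := mul_le_mul_of_nonneg_right hq v.cast_nonneg
  have := mul_le_mul_of_nonneg_right hq' v.cast_nonneg
  have := mul_le_mul_of_nonneg_right hr w.cast_nonneg
  have := mul_le_mul_of_nonneg_right hr' w.cast_nonneg
  constructor
  · have : (10000 * y + 9275 * u + 7878 * v + 5187 * w : ℝ) ≤ 183750 := by linarith
    exact_mod_cast this
  · have : (139650 : ℝ) ≤ 10000 * y + 9276 * u + 7880 * v + 5188 * w := by linarith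
    exact_mod_cast this

lemma exists_mem_step {S S' : List ℕ} {d c n j l : ℕ} {p q : ℕ × ℕ} (hS : step S d = some S')
    (hd : d ≤ 1) (hc : c ∈ S) (h : Codes c n j l) (hp : p ∈ offsets (letter j))
    (hq : q ∈ offsets (letter l))
    (hw : |W.weight (blockStart n + d) (blockStart j + p.1) (blockStart l + q.1)| ≤ 2.2) :
    ∃ c' ∈ S', Codes c' (blockStart n + d) (blockStart j + p.1) (blockStart l + q.1) := by
  obtain ⟨hr, hm⟩ := step_eq_some hS
  obtain ⟨hn, hy⟩ := h.next hd (hr c hc) hp hq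
  refine ⟨_, (hm _).2 ⟨c, hc, p, by rwa [h.left], q, by rwa [h.right], ?_, rfl⟩, hn⟩
  have h₁ := mem_offsets.1 hp
  have h₂ := mem_offsets.1 hq
  obtain ⟨-, h₁, h₂, h₃⟩ := diff_blockStart (d := d) (e := p.1) (f := q.1) hd (by omega) (by omega)
    n j l
  refine W.near_of_abs_weight_le hw hy ?_ ?_ ?_
  · rw [h₁, h.zero, Nat.div_div_eq_div_mul]
  · rw [h₂, h.one, Nat.div_div_eq_div_mul]
  · rw [h₃, h.two]

/-- Every triple with first entry `n` of small weight is encoded in `S`. -/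
def Complete (S : List ℕ) (n : ℕ) : Prop :=
  ∀ j l, |W.weight n j l| ≤ 2.2 → ∃ c ∈ S, Codes c n j l

lemma Complete.step {S S' : List ℕ} {d n : ℕ} (h : W.Complete S n) (hd : d ≤ 1)
    (hS : step S d = some S') : W.Complete S' (blockStart n + d) := by
  intro j l hw
  obtain ⟨j, e, rfl, he⟩ := exists_offset j
  obtain ⟨l, f, rfl, hf⟩ := exists_offset l
  have h₁ := mem_offsets.1 he
  have h₂ := mem_offsets.1 hf
  obtain ⟨c, hc, hcode⟩ := h j l (W.abs_weight_le hd (by omega) (by omega) hw)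
  exact W.exists_mem_step hS hd hc hcode he hf hw

end Weights

/-- Every element of `S` encodes some triple with first entry `n`. -/
def Sound (S : List ℕ) (n : ℕ) : Prop := ∀ c ∈ S, ∃ j l, Codes c n j l

lemma Sound.step {S S' : List ℕ} {d n : ℕ} (h : Sound S n) (hd : d ≤ 1)
    (hS : step S d = some S') : Sound S' (blockStart n + d) := by
  intro k hk
  obtain ⟨hr, hm⟩ := step_eq_some hS
  obtain ⟨c, hc, p, hp, q, hq, -, rfl⟩ := (hm k).1 hk
  obtain ⟨j, l, h⟩ := h c hc
  exact ⟨_, _, (h.next hd (hr c hc) (by rwa [← h.left]) (by rwa [← h.right])).1⟩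

/-- The natural number with digits `ds`, most significant first, following those of `n`. -/
def num (n : ℕ) (ds : List ℕ) : ℕ := ds.foldl (fun n d => blockStart n + d) n

lemma le_num (n : ℕ) (ds : List ℕ) : n ≤ num n ds := by
  induction ds generalizing n with
  | nil => rfl
  | cons d ds ih => exact (le_blockStart n).trans ((Nat.le_add_right _ d).trans (ih _))

lemma lt_num (n : ℕ) (ds : List ℕ) : n < num n (1 :: ds) :=
  (Nat.lt_succ_of_le (le_blockStart n)).trans_le (le_num _ ds)

/-- The state of the automaton after reading the digits `ds`. -/
def run (S ds : List ℕ) : Option (List ℕ) := ds.foldlM step S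

/-- `S` encodes all triples with first entry `n` of small weight, and nothing superfluous. -/
def Describes (W : Weights) (S : List ℕ) (n : ℕ) : Prop := Sound S n ∧ W.Complete S n

variable {W : Weights}

lemma Sound.run {S S' ds : List ℕ} {n : ℕ} (h : Sound S n) (hds : ∀ d ∈ ds, d ≤ 1)
    (hS : run S ds = some S') : Sound S' (num n ds) := by
  induction ds generalizing S n with
  | nil => cases hS; exact h
  | cons d ds ih =>
    simp only [FourBonacci.run, List.foldlM_cons, Option.bind_eq_bind,
      Option.bind_eq_some_iff] at hS
    obtain ⟨T, hT, hS⟩ := hS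
    exact ih (h.step (hds d (by simp)) hT) (fun x hx => hds x (by simp [hx])) hS

lemma Describes.run {S S' ds : List ℕ} {n : ℕ} (h : Describes W S n) (hds : ∀ d ∈ ds, d ≤ 1)
    (hS : run S ds = some S') : Describes W S' (num n ds) := by
  induction ds generalizing S n with
  | nil => cases hS; exact h
  | cons d ds ih =>
    simp only [FourBonacci.run, List.foldlM_cons, Option.bind_eq_bind,
      Option.bind_eq_some_iff] at hS
    obtain ⟨T, hT, hS⟩ := hS
    have hd := hds d (by simp)
    exact ih ⟨h.1.step hd hT, h.2.step W hd hT⟩ (fun x hx => hds x (by simp [hx])) hS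

/-- The code of the zero vector between two letters `0`. -/
def origin : ℕ := 349520

lemma codes_origin : Codes origin 0 0 0 := by
  have : letter 0 = 0 := letter_blockStart 0
  constructor <;> simp [diff, occ_zero, origin, this]

/-- The state describing `0`. -/
def initialState : List ℕ := (run [origin] [0, 0, 0, 0, 0, 0]).getD []

lemma run_origin : run [origin] [0, 0, 0, 0, 0, 0] = some initialState := by decide +kernel

lemma step_initialState : step initialState 0 = some initialState := by decide +kernel

lemma origin_mem_initialState : origin ∈ initialState := by decide +kernel

lemma describes_initialState : Describes W initialState 0 := by
  constructor
  · refine Sound.run (n := 0) ?_ (by decide) run_origin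
    intro c hc
    rw [List.mem_singleton.1 hc]
    exact ⟨0, 0, codes_origin⟩
  · intro j l
    induction h : j + l using Nat.strong_induction_on generalizing j l with
    | _ s ih =>
      intro hw
      obtain ⟨j, e, rfl, he⟩ := exists_offset j
      obtain ⟨l, f, rfl, hf⟩ := exists_offset l
      by_cases h0 : blockStart j + e + (blockStart l + f) = 0
      · rw [Nat.add_eq_zero_iff] at h0
        rw [h0.1, h0.2]
        exact ⟨origin, origin_mem_initialState, codes_origin⟩
      have hj := le_blockStart j
      have hl := le_blockStart l
      have hj' : j = 0 ∨ j < blockStart j := j.eq_zero_or_pos.imp_right lt_blockStart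
      have hl' : l = 0 ∨ l < blockStart l := l.eq_zero_or_pos.imp_right lt_blockStart
      have h₁ := mem_offsets.1 he
      have h₂ := mem_offsets.1 hf
      have hw' := W.abs_weight_le (d := 0) (n := 0) zero_le_one (by omega) (by omega) hw
      obtain ⟨c, hc, hcode⟩ := ih (j + l) (by omega) j l rfl hw'
      exact W.exists_mem_step step_initialState zero_le_one hc hcode he hf hw

/-- The state describing the numbers with digits `1 ^ (4 k + 5)`. -/
def cycleState : List ℕ := (run initialState [1, 1, 1, 1, 1]).getD []

lemma run_initialState : run initialState [1, 1, 1, 1, 1] = some cycleState := by decide +kernel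

lemma run_cycleState : run cycleState [1, 1, 1, 1] = some cycleState := by decide +kernel

lemma exists_describes_cycleState (k : ℕ) : ∃ n, k < n ∧ Describes W cycleState n := by
  induction k with
  | zero =>
    exact ⟨_, lt_num 0 _, describes_initialState.run (by decide) run_initialState⟩
  | succ k ih =>
    obtain ⟨n, hn, h⟩ := ih
    exact ⟨_, (Nat.succ_le_of_lt hn).trans_lt (lt_num n _), h.run (by decide) run_cycleState⟩

/-- The vectors of coordinate sum zero encoded in `S`. -/
def balanced (S : List ℕ) : List ℕ :=
  ((S.map fun c => c / 16).filter fun v =>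
    Nat.beq (v / 4096 + v / 256 % 16 + v / 16 % 16 + v % 16) 20).dedup

lemma mem_balanced {S : List ℕ} {v : ℕ} :
    v ∈ balanced S ↔ (∃ c ∈ S, c / 16 = v) ∧
      v / 4096 + v / 256 % 16 + v / 16 % 16 + v % 16 = 20 := by
  simp [balanced]

/-- The test that the weight is at most `1.7`. -/
def centered (v : ℕ) : Bool :=
  Nat.ble (10000 * (v / 4096) + 9276 * (v / 256 % 16) + 7880 * (v / 16 % 16) + 5188 * (v % 16))
    178700 &&
  Nat.ble 144720
    (10000 * (v / 4096) + 9275 * (v / 256 % 16) + 7878 * (v / 16 % 16) + 5187 * (v % 16))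

/-- The abelian complexity at the numbers described by `S`. -/
def value (S : List ℕ) : ℕ := bif (balanced S).all centered then (balanced S).length else 0

lemma Weights.abs_weight_le_of_centered {c n j l : ℕ} (h : Codes c n j l)
    (hc : centered (c / 16) = true) : |W.weight n j l| ≤ 1.7 := by
  simp only [centered, Bool.and_eq_true, Nat.ble_eq, Nat.div_div_eq_div_mul, Nat.reduceMul] at hc
  rw [weight, h.zero, h.one, h.two, h.three, abs_le]
  generalize c / 65536 = y at *
  generalize c / 4096 % 16 = u at *
  generalize c / 256 % 16 = v at *
  generalize c / 16 % 16 = w at *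
  push_cast
  obtain ⟨hp, hp'⟩ := W.p_bounds
  obtain ⟨hq, hq'⟩ := W.q_bounds
  obtain ⟨hr, hr'⟩ := W.r_bounds
  have := mul_le_mul_of_nonneg_right hp u.cast_nonneg
  have := mul_le_mul_of_nonneg_right hp' u.cast_nonneg
  have := mul_le_mul_of_nonneg_right hq v.cast_nonneg
  have := mul_le_mul_of_nonneg_right hq' v.cast_nonneg
  have := mul_le_mul_of_nonneg_right hr w.cast_nonneg
  have := mul_le_mul_of_nonneg_right hr' w.cast_nonneg
  have h₁ : (10000 * y + 9276 * u + 7880 * v + 5188 * w : ℝ) ≤ 178700 := by exact_mod_cast hc.1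
  have h₂ : (144720 : ℝ) ≤ 10000 * y + 9275 * u + 7878 * v + 5187 * w := by exact_mod_cast hc.2
  constructor <;> linarith

lemma sum_diff (n j l : ℕ) :
    diff n j l 0 + diff n j l 1 + diff n j l 2 + diff n j l 3 = l - j - n := by
  have := sum_occ n
  have := sum_occ j
  have := sum_occ l
  simp only [diff]
  omega

lemma Codes.mem_balanced {S : List ℕ} {c n i : ℕ} (h : Codes c n i (i + n)) (hc : c ∈ S) :
    c / 16 ∈ balanced S := by
  refine FourBonacci.mem_balanced.2 ⟨⟨c, hc, rfl⟩, ?_⟩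
  have := sum_diff n i (i + n)
  rw [h.zero, h.one, h.two, h.three] at this
  simp only [Nat.div_div_eq_div_mul, Nat.reduceMul]
  omega

lemma Sound.exists_codes {S : List ℕ} {n v : ℕ} (h : Sound S n) (hv : v ∈ balanced S) :
    ∃ c i, c / 16 = v ∧ Codes c n i (i + n) := by
  obtain ⟨⟨c, hc, rfl⟩, hs⟩ := mem_balanced.1 hv
  obtain ⟨j, l, hcode⟩ := h c hc
  have := sum_diff n j l
  rw [hcode.zero, hcode.one, hcode.two, hcode.three] at this
  simp only [Nat.div_div_eq_div_mul, Nat.reduceMul] at hs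
  obtain rfl : l = j + n := by omega
  exact ⟨c, j, rfl, hcode⟩

lemma Weights.abs_weight_succ_le (W : Weights) {n i : ℕ} (h : |W.weight n i (i + n)| ≤ 1.7) :
    |W.weight n (i + 1) (i + 1 + n)| ≤ 2.2 := by
  rw [abs_le] at *
  have hi := letter_le i
  have hl := letter_le (i + n)
  have := W.p_bounds
  have := W.q_bounds
  have := W.r_bounds
  rw [add_right_comm]
  simp only [weight, diff, occ_succ] at *
  interval_cases letter i <;> interval_cases letter (i + n) <;> push_cast <;> norm_num at * <;>
    constructor <;> linarith

lemma Weights.Complete.exists_codes {S : List ℕ} {n : ℕ} (h : W.Complete S n)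
    (hS : ∀ v ∈ balanced S, centered v = true) (i : ℕ) : ∃ c ∈ S, Codes c n i (i + n) := by
  suffices |W.weight n i (i + n)| ≤ 1.7 from h _ _ (this.trans (by norm_num))
  induction i with
  | zero => simp [weight, diff, occ_zero]; norm_num
  | succ i ih =>
    obtain ⟨c, hc, hcode⟩ := h _ _ (W.abs_weight_succ_le ih)
    exact abs_weight_le_of_centered hcode (hS _ (hcode.mem_balanced hc))

/-- The Parikh vector of a factor of length `n` with the deviation encoded in `v`. -/
def decode (n v : ℕ) : ℕ → ℕ
  | 0 => v / 4096 + occ 0 n - 5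
  | 1 => v / 256 % 16 + occ 1 n - 5
  | 2 => v / 16 % 16 + occ 2 n - 5
  | 3 => v % 16 + occ 3 n - 5
  | _ => 0

lemma Codes.decode_eq {c n i : ℕ} (h : Codes c n i (i + n)) :
    decode n (c / 16) = fun ℓ => occ ℓ (i + n) - occ ℓ i := by
  obtain ⟨h₀, h₁, h₂, h₃, -, -⟩ := h
  simp only [diff] at h₀ h₁ h₂ h₃
  funext ℓ
  match ℓ with
  | 0 => simp only [decode, Nat.div_div_eq_div_mul]; omega
  | 1 => simp only [decode, Nat.div_div_eq_div_mul]; omega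
  | 2 => simp only [decode, Nat.div_div_eq_div_mul]; omega
  | 3 => simp only [decode]; omega
  | ℓ + 4 => simp [decode, occ_eq_zero]

lemma Codes.eq_of_decode_eq {c c' n i i' : ℕ} (h : Codes c n i (i + n))
    (h' : Codes c' n i' (i' + n)) (he : decode n (c / 16) = decode n (c' / 16)) :
    c / 16 = c' / 16 := by
  have m₀ := occ_mono 0 (Nat.le_add_right i n)
  have m₁ := occ_mono 1 (Nat.le_add_right i n)
  have m₂ := occ_mono 2 (Nat.le_add_right i n)
  have m₃ := occ_mono 3 (Nat.le_add_right i n)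
  have m₀' := occ_mono 0 (Nat.le_add_right i' n)
  have m₁' := occ_mono 1 (Nat.le_add_right i' n)
  have m₂' := occ_mono 2 (Nat.le_add_right i' n)
  have m₃' := occ_mono 3 (Nat.le_add_right i' n)
  rw [h.decode_eq, h'.decode_eq] at he
  have e₀ := congrFun he 0
  have e₁ := congrFun he 1
  have e₂ := congrFun he 2
  have e₃ := congrFun he 3
  obtain ⟨h₀, h₁, h₂, h₃, -, -⟩ := h
  obtain ⟨h₀', h₁', h₂', h₃', -, -⟩ := h'
  simp only [diff] at *
  have d₀ : c / 65536 = c' / 65536 := by omega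
  have d₁ : c / 4096 % 16 = c' / 4096 % 16 := by omega
  have d₂ : c / 256 % 16 = c' / 256 % 16 := by omega
  have d₃ : c / 16 % 16 = c' / 16 % 16 := by omega
  clear * - d₀ d₁ d₂ d₃
  omega

lemma Describes.mbAC_eq_value {S : List ℕ} {n : ℕ} (h : Describes W S n) (hS : value S ≠ 0) :
    mbAC 4 n = value S := by
  rw [value] at hS ⊢
  cases hB : (balanced S).all centered
  · simp [hB] at hS
  rw [cond_true, mbAC_eq]
  have hrange : (Set.range fun i ℓ => occ ℓ (i + n) - occ ℓ i) =
      decode n '' ((balanced S).toFinset : Set ℕ) := by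
    ext g
    simp only [Set.mem_range, Set.mem_image, SetLike.mem_coe, List.mem_toFinset]
    constructor
    · rintro ⟨i, rfl⟩
      obtain ⟨c, hc, hcode⟩ := h.2.exists_codes (List.all_eq_true.1 hB) i
      exact ⟨_, hcode.mem_balanced hc, hcode.decode_eq⟩
    · rintro ⟨v, hv, rfl⟩
      obtain ⟨c, i, rfl, hcode⟩ := h.1.exists_codes hv
      exact ⟨i, hcode.decode_eq.symm⟩
  rw [hrange, Set.InjOn.ncard_image, Set.ncard_coe_finset, List.card_toFinset, balanced,
    List.dedup_idem]
  intro v hv w hw he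
  simp only [SetLike.mem_coe, List.mem_toFinset] at hv hw
  obtain ⟨c, i, rfl, hcode⟩ := h.1.exists_codes hv
  obtain ⟨c', i', rfl, hcode'⟩ := h.1.exists_codes hw
  exact hcode.eq_of_decode_eq hcode' he

/-- The values of the states reached from `S` by the nonempty prefixes of a list of digits. -/
def profile : List ℕ → List ℕ → List ℕ
  | _, [] => []
  | S, d :: ds =>
    match step S d with
    | none => []
    | some S' => value S' :: profile S' ds

lemma exists_of_mem_profile {S ds : List ℕ} {c : ℕ} (h : c ∈ profile S ds) :
    ∃ k S', run S (ds.take k) = some S' ∧ value S' = c := by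
  induction ds generalizing S with
  | nil => simp [profile] at h
  | cons d ds ih =>
    rw [profile] at h
    cases hS : step S d with
    | none => simp [hS] at h
    | some T =>
      rw [hS, List.mem_cons] at h
      rcases h with rfl | h
      · exact ⟨1, T, by simp [run, hS], rfl⟩
      · obtain ⟨k, S', hk, hv⟩ := ih h
        refine ⟨k + 1, S', ?_, hv⟩
        simpa [run, hS] using hk

/-- A sequence of digits leading from `cycleState` through states with all the values from `7` to
`16`. -/
def spread : List ℕ := [0, 0, 1, 0, 0, 0, 1, 0, 0, 0, 1, 0, 0, 0, 1, 0, 0, 0, 1]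

lemma profile_spread : profile cycleState spread =
    [7, 7, 8, 8, 9, 9, 9, 10, 10, 11, 11, 11, 12, 13, 14, 15, 15, 15, 16] := by
  decide +kernel

end FourBonacci

theorem fourbonacci_values_attained_infinitely_often (c : ℕ)
    (hc : 7 ≤ c) (hc16 : c ≤ 16) :
    {n : ℕ | 1 ≤ n ∧ mbAC 4 n = c}.Infinite := by
  obtain ⟨W⟩ := FourBonacci.nonempty_weights
  have hmem : c ∈ FourBonacci.profile FourBonacci.cycleState FourBonacci.spread := by
    rw [FourBonacci.profile_spread]
    interval_cases c <;> simp
  obtain ⟨k, S, hk, rfl⟩ := FourBonacci.exists_of_mem_profile hmem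
  refine Set.infinite_of_forall_exists_gt fun a => ?_
  obtain ⟨n, hn, h⟩ := FourBonacci.exists_describes_cycleState (W := W) a
  have hd : ∀ d ∈ FourBonacci.spread.take k, d ≤ 1 := fun d hd =>
    (by decide : ∀ d ∈ FourBonacci.spread, d ≤ 1) d (List.mem_of_mem_take hd)
  have hlt := hn.trans_le (FourBonacci.le_num n (FourBonacci.spread.take k))
  exact ⟨_, ⟨Nat.one_le_of_lt hlt, (h.run hd hk).mbAC_eq_value (by omega)⟩, hlt⟩
end

section
/- The 4-bonacci word q is 3-balanced: for every letter ℓ ∈ {0,1,2,3} and every pair of factors v, w of q with |v| = |w|, one has ||v|_ℓ − |w|_ℓ| ≤ 3. -/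
/-- A half-space-like cone of count vectors `(a, b, c, d)` (together with its negative) which is
preserved by the recurrence and contains no vector of coordinate sum zero. -/
def Escaping (a b c d : ℤ) : Prop :=
  (3 ≤ a + b + c + d ∧ 5 ≤ 2 * a + 2 * b + 2 * c + d ∧ 9 ≤ 4 * a + 4 * b + 3 * c + 2 * d ∧
    17 ≤ 8 * a + 7 * b + 6 * c + 4 * d) ∨
  (a + b + c + d ≤ -3 ∧ 2 * a + 2 * b + 2 * c + d ≤ -5 ∧ 4 * a + 4 * b + 3 * c + 2 * d ≤ -9 ∧
    8 * a + 7 * b + 6 * c + 4 * d ≤ -17)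

instance (a b c d : ℤ) : Decidable (Escaping a b c d) := by
  unfold Escaping; infer_instance

/-- The integers of absolute value at most three. -/
def smallInts : List ℤ := [-3, -2, -1, 0, 1, 2, 3]

/-- Bit mask of the 499 vectors in `smallInts ^ 4` that are reachable from zero under
`(a, b, c, d) ↦ (a + b + c + d + D, a, b, c)` with `|D| ≤ 2` without entering `Escaping`;
coordinates are read as base seven digits after a shift by three. -/
def boundedMask : ℕ :=
  62267772750859263472022496889670226005222028625534143088093234684919612153448402893751812156594485129994977036063743528827467413677586096933832424310760190401803957681784759951630753776166536701902493140626224875036426374861038246099664897718618211596720497225622305322911830511350980154793117366848633549119666622127837867522300426168756162249194287547938305760245391783756157053496690227340447626512184640566748879717442219256603157124715515109996826906291239480160418782757930481200585748315828870982867038191550438995557390236927074855794489979101473372869864902408604267609176440767315706992275956414778832558318440292758793698562136015175376530223968219688121351486637582968981929326576402432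

/-- Membership in the finite set encoded by `boundedMask`. -/
def IsBounded (a b c d : ℤ) : Prop :=
  boundedMask.testBit (343 * (a + 3) + 49 * (b + 3) + 7 * (c + 3) + (d + 3)).toNat = true

instance (a b c d : ℤ) : Decidable (IsBounded a b c d) := by
  unfold IsBounded; infer_instance

set_option maxRecDepth 100000 in
theorem isBounded_step : ∀ a ∈ smallInts, ∀ b ∈ smallInts, ∀ c ∈ smallInts, ∀ d ∈ smallInts,
    IsBounded a b c d → ∀ D ∈ [(-2 : ℤ), -1, 0, 1, 2],
      Escaping (a + b + c + d + D) a b c ∨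
        (a + b + c + d + D ∈ smallInts ∧ IsBounded (a + b + c + d + D) a b c) := by
  decide +kernel

theorem isBounded_zero : IsBounded 0 0 0 0 := by
  decide +kernel

/-- The invariant satisfied by all differences of count vectors. -/
def Admissible (a b c d : ℤ) : Prop :=
  Escaping a b c d ∨
    (a ∈ smallInts ∧ b ∈ smallInts ∧ c ∈ smallInts ∧ d ∈ smallInts ∧ IsBounded a b c d)

theorem mem_smallInts {a : ℤ} : a ∈ smallInts ↔ -3 ≤ a ∧ a ≤ 3 := by
  simp only [smallInts, List.mem_cons, List.not_mem_nil, or_false]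
  omega

theorem Escaping.step {a b c d D : ℤ} (h : Escaping a b c d) (h₁ : -2 ≤ D) (h₂ : D ≤ 2) :
    Escaping (a + b + c + d + D) a b c := by
  unfold Escaping at *
  omega

theorem Admissible.step {a b c d D : ℤ} (h : Admissible a b c d) (h₁ : -2 ≤ D) (h₂ : D ≤ 2) :
    Admissible (a + b + c + d + D) a b c := by
  rcases h with h | ⟨ha, hb, hc, hd, h⟩
  · exact Or.inl (h.step h₁ h₂)
  · have hD : D ∈ [(-2 : ℤ), -1, 0, 1, 2] := by
      simp only [List.mem_cons, List.not_mem_nil, or_false]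
      omega
    rcases isBounded_step a ha b hb c hc d hd h D hD with h | ⟨he, h⟩
    · exact Or.inl h
    · exact Or.inr ⟨he, ha, hb, hc, h⟩

theorem Admissible.abs_le_three {a b c d : ℤ} (h : Admissible a b c d) (h₀ : a + b + c + d = 0) :
    |a| ≤ 3 ∧ |b| ≤ 3 ∧ |c| ≤ 3 ∧ |d| ≤ 3 := by
  rcases h with h | ⟨ha, hb, hc, hd, -⟩
  · unfold Escaping at h
    omega
  · rw [mem_smallInts] at ha hb hc hd
    simp only [abs_le]
    exact ⟨ha, hb, hc, hd⟩

theorem mbApply_append (m : ℕ) (u v : List ℕ) :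
    mbApply m (u ++ v) = mbApply m u ++ mbApply m v := by
  simp [mbApply]

theorem mbApply_cons (m x : ℕ) (u : List ℕ) : mbApply m (x :: u) = mbSub m x ++ mbApply m u := by
  simp [mbApply]

theorem mbIter_succ (m k : ℕ) : mbIter m (k + 1) = mbApply m (mbIter m k) := by
  simp only [mbIter, Function.iterate_succ_apply']

theorem mbIter_prefix_succ (m k : ℕ) : mbIter m k <+: mbIter m (k + 1) := by
  induction k with
  | zero =>
    simp only [mbIter, Function.iterate_succ_apply', Function.iterate_zero, id, mbApply, mbSub,
      List.flatMap_cons, List.flatMap_nil, List.append_nil]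
    split_ifs <;> simp
  | succ k ih =>
    obtain ⟨t, ht⟩ := ih
    exact ⟨mbApply m t, by rw [mbIter_succ m (k + 1), ← ht, mbApply_append, ← mbIter_succ, ht]⟩

theorem mbIter_prefix_of_le (m : ℕ) {j k : ℕ} (h : j ≤ k) : mbIter m j <+: mbIter m k := by
  induction k, h using Nat.le_induction with
  | base => exact List.prefix_rfl
  | succ k _ ih => exact ih.trans (mbIter_prefix_succ m k)

theorem lt_of_mem_mbIter {m k x : ℕ} (hm : 0 < m) (hx : x ∈ mbIter m k) : x < m := by
  induction k generalizing x with
  | zero => simp_all [mbIter]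
  | succ k ih =>
    rw [mbIter_succ, mbApply, List.mem_flatMap] at hx
    obtain ⟨y, hy, hx⟩ := hx
    have := ih hy
    unfold mbSub at hx
    split_ifs at hx <;> simp at hx <;> omega

/-- A prefix of `σ(u)` is `σ(p)`, or `σ(p)` followed by a single `0`, for some prefix `p` of `u`. -/
theorem exists_prefix_of_prefix_mbApply {m : ℕ} {u p : List ℕ} (h : p <+: mbApply m u) :
    ∃ p', p' <+: u ∧ (p = mbApply m p' ∨ p = mbApply m p' ++ [0]) := by
  induction u generalizing p with
  | nil => exact ⟨[], by simp, Or.inl (by simpa [mbApply] using h)⟩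
  | cons x u ih =>
    rw [mbApply_cons] at h
    have hx := List.prefix_append (mbSub m x) (mbApply m u)
    rcases le_total p.length (mbSub m x).length with hl | hl
    · have h' := List.prefix_of_prefix_length_le h hx hl
      unfold mbSub at h'
      rcases p with _ | ⟨a, _ | ⟨b, p⟩⟩
      · exact ⟨[], by simp, Or.inl rfl⟩
      · refine ⟨[], by simp, Or.inr ?_⟩
        split_ifs at h' <;> simp_all [mbApply]
      · refine ⟨[x], by simp, Or.inl ?_⟩
        split_ifs at h' <;> simp_all [mbApply, mbSub]
    · obtain ⟨t, rfl⟩ := List.prefix_of_prefix_length_le hx h hl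
      obtain ⟨p', hp', h⟩ := ih ((List.prefix_append_right_inj _).1 h)
      refine ⟨x :: p', (List.prefix_cons_inj x).2 hp', ?_⟩
      rw [mbApply_cons, List.append_assoc]
      exact h.imp (congrArg _) (congrArg _)

theorem count_zero_mbApply (m : ℕ) (u : List ℕ) : (mbApply m u).count 0 = u.length := by
  induction u with
  | nil => rfl
  | cons x u ih =>
    rw [mbApply_cons, List.count_append, ih, mbSub]
    split_ifs <;> simp [Nat.add_comm]

theorem count_succ_mbApply {m i : ℕ} (hi : i ≠ m - 1) (u : List ℕ) :
    (mbApply m u).count (i + 1) = u.count i := by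
  induction u with
  | nil => rfl
  | cons x u ih =>
    rw [mbApply_cons, List.count_append, ih, mbSub, List.count_cons]
    split_ifs <;> (simp_all; try omega)

theorem length_eq_sum_count_of_lt_four {u : List ℕ} (h : ∀ x ∈ u, x < 4) :
    u.length = u.count 0 + u.count 1 + u.count 2 + u.count 3 := by
  induction u with
  | nil => rfl
  | cons x u ih =>
    have hx := h x (by simp)
    have := ih fun y hy => h y (by simp [hy])
    simp only [List.length_cons, List.count_cons, beq_iff_eq]
    interval_cases x <;> (simp; omega)

theorem prefix_mbIter_four_length {k : ℕ} {p : List ℕ} (h : p <+: mbIter 4 k) :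
    p.length = p.count 0 + p.count 1 + p.count 2 + p.count 3 :=
  length_eq_sum_count_of_lt_four fun _ hx => lt_of_mem_mbIter (by norm_num) (h.subset hx)

/-- The letter counts of a prefix of `σ^(k+1)(0)` in terms of those of a prefix of `σ^k(0)`. -/
theorem exists_prefix_count {k : ℕ} {p : List ℕ} (h : p <+: mbIter 4 (k + 1)) :
    ∃ p', p' <+: mbIter 4 k ∧ ∃ e : ℕ, e ≤ 1 ∧
      p.count 0 = p'.count 0 + p'.count 1 + p'.count 2 + p'.count 3 + e ∧
      p.count 1 = p'.count 0 ∧ p.count 2 = p'.count 1 ∧ p.count 3 = p'.count 2 := by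
  rw [mbIter_succ] at h
  obtain ⟨p', hp', h⟩ := exists_prefix_of_prefix_mbApply h
  have h₀ := count_zero_mbApply 4 p'
  have h₁ := count_succ_mbApply (m := 4) (i := 0) (by norm_num) p'
  have h₂ := count_succ_mbApply (m := 4) (i := 1) (by norm_num) p'
  have h₃ := count_succ_mbApply (m := 4) (i := 2) (by norm_num) p'
  rw [prefix_mbIter_four_length hp'] at h₀
  rcases h with rfl | rfl
  · exact ⟨p', hp', 0, by norm_num, h₀, h₁, h₂, h₃⟩
  · refine ⟨p', hp', 1, le_rfl, ?_, ?_, ?_, ?_⟩ <;> simp_all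

theorem admissible_count (k : ℕ) {p q r s : List ℕ} (hp : p <+: mbIter 4 k)
    (hq : q <+: mbIter 4 k) (hr : r <+: mbIter 4 k) (hs : s <+: mbIter 4 k) :
    Admissible (p.count 0 + q.count 0 - r.count 0 - s.count 0)
      (p.count 1 + q.count 1 - r.count 1 - s.count 1)
      (p.count 2 + q.count 2 - r.count 2 - s.count 2)
      (p.count 3 + q.count 3 - r.count 3 - s.count 3) := by
  induction k generalizing p q r s with
  | zero =>
    have key : ∀ {t : List ℕ}, t <+: mbIter 4 0 →
        t.count 0 ≤ 1 ∧ t.count 1 = 0 ∧ t.count 2 = 0 ∧ t.count 3 = 0 := by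
      intro t ht
      have h := fun x => ht.sublist.count_le x
      exact ⟨h 0, Nat.le_zero.1 (h 1), Nat.le_zero.1 (h 2), Nat.le_zero.1 (h 3)⟩
    obtain ⟨hp, hp₁, hp₂, hp₃⟩ := key hp
    obtain ⟨hq, hq₁, hq₂, hq₃⟩ := key hq
    obtain ⟨hr, hr₁, hr₂, hr₃⟩ := key hr
    obtain ⟨hs, hs₁, hs₂, hs₃⟩ := key hs
    have h₀ : Admissible 0 0 0 0 :=
      Or.inr (by simpa [mem_smallInts] using isBounded_zero)
    convert h₀.step (D := p.count 0 + q.count 0 - r.count 0 - s.count 0) (by omega) (by omega)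
      using 1 <;> omega
  | succ k ih =>
    obtain ⟨p', hp, e, he, hp₀, hp₁, hp₂, hp₃⟩ := exists_prefix_count hp
    obtain ⟨q', hq, f, hf, hq₀, hq₁, hq₂, hq₃⟩ := exists_prefix_count hq
    obtain ⟨r', hr, g, hg, hr₀, hr₁, hr₂, hr₃⟩ := exists_prefix_count hr
    obtain ⟨s', hs, i, hi, hs₀, hs₁, hs₂, hs₃⟩ := exists_prefix_count hs
    convert (ih hp hq hr hs).step (D := e + f - g - i) (by omega) (by omega) using 1 <;> omega

theorem mbFactor.exists_prefixes {m : ℕ} {w : List ℕ} (h : mbFactor m w) :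
    ∃ k, ∀ j, k ≤ j → ∃ x, x <+: mbIter m j ∧ x ++ w <+: mbIter m j := by
  obtain ⟨k, x, y, h⟩ := h
  have hxw : x ++ w <+: mbIter m k := ⟨y, h⟩
  refine ⟨k, fun j hj => ⟨x, ?_, hxw.trans (mbIter_prefix_of_le m hj)⟩⟩
  exact (List.prefix_append x w).trans (hxw.trans (mbIter_prefix_of_le m hj))

theorem fourbonacci_three_balanced (ℓ : ℕ) (hℓ : ℓ < 4) (v w : List ℕ)
    (hv : mbFactor 4 v) (hw : mbFactor 4 w) (hlen : v.length = w.length) :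
    |(v.count ℓ : ℤ) - (w.count ℓ : ℤ)| ≤ 3 := by
  obtain ⟨j, hj⟩ := hv.exists_prefixes
  obtain ⟨k, hk⟩ := hw.exists_prefixes
  obtain ⟨x, hx, hxv⟩ := hj (max j k) (le_max_left _ _)
  obtain ⟨y, hy, hyw⟩ := hk (max j k) (le_max_right _ _)
  have h := admissible_count _ hxv hy hx hyw
  have h₁ := prefix_mbIter_four_length hxv
  have h₂ := prefix_mbIter_four_length hyw
  have h₃ := prefix_mbIter_four_length hx
  have h₄ := prefix_mbIter_four_length hy
  simp only [List.count_append, List.length_append] at h h₁ h₂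
  obtain ⟨ha, hb, hc, hd⟩ := h.abs_le_three (by push_cast; omega)
  push_cast at ha hb hc hd
  rw [abs_le] at *
  interval_cases ℓ <;> omega
end
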